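/- The ideal generated by y_1^2 − x_1^3 + x_1 + 2 and (x_1^n + 1)^2 − x_2^3 + x_2 + 2 in the polynomial ring ℚ[x_1, x_2, y_1] is prime, for every positive integer n. -/

import Mathlib

open MvPolynomial

lemma irr2 : Irreducible (Polynomial.X ^ 2 + 2 : Polynomial ℚ) := by
  have hd : (Polynomial.X ^ 2 + 2 : Polynomial ℚ).natDegree = 2 := by
    rw [show (2 : Polynomial ℚ) = Polynomial.C 2 from rfl]; compute_degree!
  rw [Polynomial.irreducible_iff_roots_eq_zero_of_degree_le_three (by omega) (by omega)]
  rw [Multiset.eq_zero_iff_forall_notMem]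
  intro a ha
  have h := Polynomial.isRoot_of_mem_roots ha
  simp [Polynomial.IsRoot] at h
  nlinarith [sq_nonneg a]

lemma irr3 : Irreducible (Polynomial.X ^ 3 - Polynomial.X - 3 : Polynomial ℚ) := by
  have hd : (Polynomial.X ^ 3 - Polynomial.X - 3 : Polynomial ℚ).natDegree = 3 := by
    rw [show (3 : Polynomial ℚ) = Polynomial.C 3 from rfl]; compute_degree!
  rw [Polynomial.irreducible_iff_roots_eq_zero_of_degree_le_three (by omega) (by omega)]
  rw [Multiset.eq_zero_iff_forall_notMem]
  intro a ha
  have h := Polynomial.isRoot_of_mem_roots ha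
  simp [Polynomial.IsRoot] at h
  have hm : (Polynomial.X ^ 3 - Polynomial.X - 3 : Polynomial ℤ).Monic := by
    rw [show (3 : Polynomial ℤ) = Polynomial.C 3 from rfl]; monicity!
  obtain ⟨z, hz⟩ := isInteger_of_is_root_of_monic (A := ℤ) (K := ℚ) hm (r := a) (by simpa [map_ofNat] using h)
  simp at hz
  subst hz
  have h2 : z ^ 3 - z - 3 = 0 := by
    apply Int.cast_injective (α := ℚ)
    push_cast
    exact h
  have h3 : (z : ZMod 2) ^ 3 - z - 3 = 0 := by exact_mod_cast congrArg (Int.cast : ℤ → ZMod 2) h2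
  revert h3
  generalize (z : ZMod 2) = w
  revert w
  decide

/-- The quadratic over `ℚ[x]`. -/
noncomputable def quadP : Polynomial (Polynomial ℚ) :=
  Polynomial.X ^ 2 + Polynomial.C (-Polynomial.X ^ 3 + Polynomial.X + 2)

/-- The cubic over `ℚ[x]`. -/
noncomputable def cubP (n : ℕ) : Polynomial (Polynomial ℚ) :=
  Polynomial.X ^ 3 - Polynomial.X + Polynomial.C (-(Polynomial.X ^ n + 1) ^ 2 - 2)

lemma quadP_monic : quadP.Monic := by unfold quadP; monicity!

lemma cubP_monic (n : ℕ) : (cubP n).Monic := by unfold cubP; monicity!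

lemma quadP_deg : quadP.natDegree = 2 := by unfold quadP; compute_degree!

lemma cubP_deg (n : ℕ) : (cubP n).natDegree = 3 := by unfold cubP; compute_degree!

lemma quadP_irr : Irreducible quadP := by
  apply Polynomial.Monic.irreducible_of_irreducible_map (Polynomial.evalRingHom (0 : ℚ)) _ quadP_monic
  convert irr2
  simp [quadP]
  rfl

lemma cubP_irr (n : ℕ) (hn : 1 ≤ n) : Irreducible (cubP n) := by
  apply Polynomial.Monic.irreducible_of_irreducible_map (Polynomial.evalRingHom (0 : ℚ)) _
    (cubP_monic n)
  convert irr3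
  have : (0 : Polynomial ℚ) ^ n = 0 := zero_pow (by omega)
  have h2 : (Polynomial.C 2 : Polynomial ℚ) = 2 := rfl
  simp [cubP, this, h2]
  ring

/-- The embedding `ℚ[x][z] → ℚ[x, z, y]`. -/
noncomputable def psi : Polynomial (Polynomial ℚ) →+* MvPolynomial (Fin 3) ℚ :=
  Polynomial.eval₂RingHom (Polynomial.aeval (X 0 : MvPolynomial (Fin 3) ℚ)).toRingHom (X 1)

lemma normal_form (I : Ideal (MvPolynomial (Fin 3) ℚ))
    (h1 : ((X 2) ^ 2 - (X 0) ^ 3 + X 0 + 2 : MvPolynomial (Fin 3) ℚ) ∈ I)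
    (p : MvPolynomial (Fin 3) ℚ) : ∃ a b, p - (psi a + psi b * X 2) ∈ I := by
  induction p using MvPolynomial.induction_on with
  | C r => 
    refine ⟨Polynomial.C (Polynomial.C r), 0, ?_⟩
    simp [psi, MvPolynomial.algebraMap_eq]
  | add p q hp hq =>
    obtain ⟨a, b, h⟩ := hp
    obtain ⟨c, d, h'⟩ := hq
    refine ⟨a + c, b + d, ?_⟩
    convert I.add_mem h h' using 1
    simp only [map_add]; ring
  | mul_X p i hp =>
    obtain ⟨a, b, h⟩ := hp
    have e0 : psi (Polynomial.C Polynomial.X) = X 0 := by simp [psi]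
    have e1 : psi Polynomial.X = X 1 := by simp [psi]
    fin_cases i
    · refine ⟨a * Polynomial.C Polynomial.X, b * Polynomial.C Polynomial.X, ?_⟩
      convert I.mul_mem_right (X 0) h using 1
      simp only [map_mul, e0, Fin.zero_eta]; ring
    · refine ⟨a * Polynomial.X, b * Polynomial.X, ?_⟩
      convert I.mul_mem_right (X 1) h using 1
      simp only [map_mul, e1, Fin.mk_one]; ring
    · refine ⟨b * (Polynomial.C Polynomial.X ^ 3 - Polynomial.C Polynomial.X - 2), a, ?_⟩
      convert I.add_mem (I.mul_mem_right (X 2) h) (I.mul_mem_left (psi b) h1) using 1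
      simp only [map_mul, map_sub, map_pow, e0, map_ofNat, Fin.reduceFinMk]; ring

theorem stmt_9 (n : ℕ) (hn : 1 ≤ n) :
    (Ideal.span
      ({(X 2) ^ 2 - (X 0) ^ 3 + X 0 + 2,
        ((X 0) ^ n + 1) ^ 2 - (X 1) ^ 3 + X 1 + 2} :
        Set (MvPolynomial (Fin 3) ℚ))).IsPrime := by
  set I := (Ideal.span
      ({(X 2) ^ 2 - (X 0) ^ 3 + X 0 + 2,
        ((X 0) ^ n + 1) ^ 2 - (X 1) ^ 3 + X 1 + 2} :
        Set (MvPolynomial (Fin 3) ℚ))) with hI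
  have h1 : ((X 2) ^ 2 - (X 0) ^ 3 + X 0 + 2 : MvPolynomial (Fin 3) ℚ) ∈ I :=
    Ideal.subset_span (by simp)
  have h2 : (((X 0) ^ n + 1) ^ 2 - (X 1) ^ 3 + X 1 + 2 : MvPolynomial (Fin 3) ℚ) ∈ I :=
    Ideal.subset_span (by simp)
  let K := FractionRing (Polynomial ℚ)
  let Ω := AlgebraicClosure K
  have q_irr : Irreducible (quadP.map (algebraMap (Polynomial ℚ) K)) :=
    (quadP_monic.irreducible_iff_irreducible_map_fraction_map).1 quadP_irr
  have c_irr : Irreducible ((cubP n).map (algebraMap (Polynomial ℚ) K)) :=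
    ((cubP_monic n).irreducible_iff_irreducible_map_fraction_map).1 (cubP_irr n hn)
  obtain ⟨α, hα⟩ := IsAlgClosed.exists_aeval_eq_zero Ω _ q_irr.degree_pos.ne'
  obtain ⟨β, hβ⟩ := IsAlgClosed.exists_aeval_eq_zero Ω _ c_irr.degree_pos.ne'
  have mα := minpoly.eq_of_irreducible_of_monic q_irr hα (quadP_monic.map _)
  have mβ := minpoly.eq_of_irreducible_of_monic c_irr hβ ((cubP_monic n).map _)
  have dα : (minpoly K α).natDegree = 2 := by
    rw [← mα, quadP_monic.natDegree_map, quadP_deg]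
  have dβ : (minpoly K β).natDegree = 3 := by
    rw [← mβ, (cubP_monic n).natDegree_map, cubP_deg]
  have iβ : IsIntegral K β := ⟨_, (cubP_monic n).map _, hβ⟩
  rw [Polynomial.aeval_map_algebraMap] at hα hβ
  have hnot : α ∉ IntermediateField.adjoin K {β} := by
    intro hmem
    have : FiniteDimensional K (IntermediateField.adjoin K {β}) :=
      IntermediateField.adjoin.finiteDimensional iβ
    have hd := minpoly.degree_dvd (K := K) (x := (⟨α, hmem⟩ : IntermediateField.adjoin K {β}))
      (IsIntegral.of_finite K _)
    rw [IntermediateField.adjoin.finrank iβ, dβ, IntermediateField.minpoly_eq, dα] at hd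
    omega
  let φ : MvPolynomial (Fin 3) ℚ →+* Ω :=
    MvPolynomial.eval₂Hom ((algebraMap (Polynomial ℚ) Ω).comp Polynomial.C)
      ![algebraMap (Polynomial ℚ) Ω Polynomial.X, β, α]
  have φ0 : φ (X 0) = algebraMap (Polynomial ℚ) Ω Polynomial.X := by simp [φ]
  have φ1 : φ (X 1) = β := by simp [φ]
  have φ2 : φ (X 2) = α := by simp [φ]
  have φψ : ∀ b, φ (psi b) = Polynomial.aeval β b := by
    intro b
    have : φ.comp psi = (Polynomial.aeval (R := Polynomial ℚ) β).toRingHom := by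
      apply Polynomial.ringHom_ext'
      · apply Polynomial.ringHom_ext'
        · exact Subsingleton.elim _ _
        · simp [psi, φ0]
      · simp [psi, φ1]
    exact congrArg (fun f => f b) this
  have hψ : ∀ b, Polynomial.aeval β b = 0 → psi b ∈ I := by
    intro b hb
    have hdvd : cubP n ∣ b := by
      apply (cubP_monic n).isPrimitive.dvd_of_fraction_map_dvd_fraction_map (K := K)
      rw [mβ]
      apply minpoly.dvd
      rwa [Polynomial.aeval_map_algebraMap]
    obtain ⟨c, rfl⟩ := hdvd
    rw [map_mul]
    apply I.mul_mem_right
    convert I.neg_mem h2 using 1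
    have e0 : psi (Polynomial.C Polynomial.X) = X 0 := by simp [psi]
    have e1 : psi Polynomial.X = X 1 := by simp [psi]
    simp only [cubP, map_add, map_sub, map_neg, map_pow, map_one, map_ofNat, e0, e1]
    ring
  have hle : I ≤ RingHom.ker φ := by
      rw [hI, Ideal.span_le]
      rintro p (rfl | rfl)
      · simp only [SetLike.mem_coe, RingHom.mem_ker, map_add, map_sub, map_pow, map_ofNat, φ0, φ2]
        rw [← hα]
        simp [quadP, map_ofNat]
        ring
      · simp only [SetLike.mem_coe, RingHom.mem_ker, map_add, map_sub, map_pow, map_ofNat, φ0, φ1,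
          map_one]
        rw [← neg_eq_zero, ← hβ]
        simp [cubP, map_ofNat]
        ring
  have hker : I = RingHom.ker φ := by
    apply le_antisymm hle
    · intro p hp
      obtain ⟨a, b, h⟩ := normal_form I h1 p
      have h0 := hle h
      rw [RingHom.mem_ker] at hp h0
      rw [map_sub, hp, map_add, map_mul, φψ, φψ, φ2] at h0
      have hb : Polynomial.aeval β b = 0 := by
        by_contra hb
        apply hnot
        have hmem : ∀ c : Polynomial (Polynomial ℚ),
            Polynomial.aeval β c ∈ IntermediateField.adjoin K {β} := by
          intro c
          rw [← Polynomial.aeval_map_algebraMap K]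
          exact IntermediateField.algebra_adjoin_le_adjoin K _
            (Polynomial.aeval_mem_adjoin_singleton _ _)
        have : α = - Polynomial.aeval β a / Polynomial.aeval β b := by
          rw [eq_div_iff hb]
          linear_combination -h0
        rw [this]
        exact div_mem (neg_mem (hmem a)) (hmem b)
      have ha : Polynomial.aeval β a = 0 := by
        rw [hb] at h0
        simpa using h0
      have := I.add_mem h (I.add_mem (hψ a ha) (I.mul_mem_right (X 2) (hψ b hb)))
      simpa using this
  rw [hker]
  exact RingHom.ker_isPrime φ
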